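/- arXiv:2409.02388 — 3 statements merged into one kernel-verified Lean document; each statement's English description precedes it below -/
import Mathlib

section
/- Let p_X be the Gaussian distribution N(μ_X, σ_X²) with σ_X > 0, and let R, R_c ∈ [0,∞], P ∈ [0,∞]. Then D(R, R_c, 2σ_X²(1 − e^{−P}) | W₂²) ≤ D(R, R_c, P | φ_KL). -/
open MeasureTheory ProbabilityTheory Real Set
open scoped ENNReal NNReal

noncomputable section

open Classical in
/-- Kullback-Leibler divergence of `q` from `p`, in `[0,∞]`. -/
def KLD {α : Type*} [MeasurableSpace α] (q p : Measure α) : ℝ≥0∞ :=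
  if q ≪ p ∧ Integrable (fun x => Real.log (q.rnDeriv p x).toReal) q
  then ENNReal.ofReal (∫ x, Real.log (q.rnDeriv p x).toReal ∂q) else ⊤

/-- Mutual information between `f` and `g` under `μ`. -/
def mutInfo {Ω α β : Type*} [MeasurableSpace Ω] [MeasurableSpace α] [MeasurableSpace β]
    (μ : Measure Ω) (f : Ω → α) (g : Ω → β) : ℝ≥0∞ :=
  KLD (μ.map (fun ω => (f ω, g ω))) ((μ.map f).prod (μ.map g))

/-- Squared Wasserstein-2 distance. -/
def W2sq (p q : Measure ℝ) : ℝ≥0∞ :=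
  ⨅ (cpl : Measure (ℝ × ℝ)) (_ : IsProbabilityMeasure cpl) (_ : cpl.map Prod.fst = p)
    (_ : cpl.map Prod.snd = q), ∫⁻ xy, ENNReal.ofReal ((xy.1 - xy.2) ^ 2) ∂cpl

/-- `exp(-x)` for `x ∈ [0,∞]`, with `exp(-∞) = 0`. -/
def expNeg (x : ℝ≥0∞) : ℝ := if x = ⊤ then 0 else Real.exp (-x.toReal)

/-- Feasibility predicate for the distortion-rate-perception function. -/
def DRPfeasible (pX : Measure ℝ) (φ : Measure ℝ → Measure ℝ → ℝ≥0∞) (R Rc P : ℝ≥0∞)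
    (μ : Measure (ℝ × ℝ × ℝ)) : Prop :=
  ∃ hμ : IsProbabilityMeasure μ,
    μ.map (fun w => w.1) = pX ∧
    (haveI := hμ
     CondIndepFun (MeasurableSpace.comap (fun w : ℝ × ℝ × ℝ => w.2.1) inferInstance)
      ((measurable_fst.comp measurable_snd).comap_le)
      (fun w : ℝ × ℝ × ℝ => w.1) (fun w : ℝ × ℝ × ℝ => w.2.2) μ) ∧
    mutInfo μ (fun w => w.1) (fun w => w.2.1) ≤ R ∧
    mutInfo μ (fun w => w.2.2) (fun w => w.2.1) ≤ R + Rc ∧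
    φ pX (μ.map (fun w => w.2.2)) ≤ P

/-- Mean squared distortion of a joint law of `(X, U, X̂)`. -/
def distortion (μ : Measure (ℝ × ℝ × ℝ)) : ℝ≥0∞ :=
  ∫⁻ w, ENNReal.ofReal ((w.1 - w.2.2) ^ 2) ∂μ

/-- The distortion-rate-perception function `D(R, R_c, P | φ)`. -/
def DRP (pX : Measure ℝ) (φ : Measure ℝ → Measure ℝ → ℝ≥0∞) (R Rc P : ℝ≥0∞) : ℝ≥0∞ :=
  ⨅ (μ : Measure (ℝ × ℝ × ℝ)) (_ : DRPfeasible pX φ R Rc P μ), distortion μ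

/-- `D(R, R_c, ∞)`: the DRP function without perception constraint. -/
def DRPinf (pX : Measure ℝ) (R Rc : ℝ≥0∞) : ℝ≥0∞ :=
  DRP pX (fun _ _ => 0) R Rc ⊤

/-- Deterministic-decoder (entropy-constrained quantization) function `D_e(R, R_c)`,
with `H(X̂) := I(X̂; X̂)`. -/
def De (pX : Measure ℝ) (R Rc : ℝ≥0∞) : ℝ≥0∞ :=
  ⨅ (cpl : Measure (ℝ × ℝ)) (_ : IsProbabilityMeasure cpl ∧ cpl.map Prod.fst = pX ∧
      mutInfo cpl Prod.fst Prod.snd ≤ R ∧ mutInfo cpl Prod.snd Prod.snd ≤ R + Rc),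
    ∫⁻ w, ENNReal.ofReal ((w.1 - w.2) ^ 2) ∂cpl

/-- The Gaussian measure `N(μ, σ²)`. -/
def gauss (μ σ : ℝ) : Measure ℝ := gaussianReal μ ⟨σ ^ 2, sq_nonneg σ⟩

end
noncomputable section

/-- `ξ(R, R_c) = √((1 - e^{-2R})(1 - e^{-2(R+R_c)}))`. -/
def xiRRc (R Rc : ℝ≥0∞) : ℝ :=
  Real.sqrt ((1 - expNeg (2 * R)) * (1 - expNeg (2 * (R + Rc))))

/-- `ψ(σ) = log(σ_X/σ) + (σ² - σ_X²)/(2σ_X²)`. -/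
def psi (σX s : ℝ) : ℝ := Real.log (σX / s) + (s ^ 2 - σX ^ 2) / (2 * σX ^ 2)

/-- `δ₊(σ̂, α)` from the improved lower bound. -/
def deltaPlus (σX : ℝ) (R Rc : ℝ≥0∞) (P s α : ℝ) : ℝ :=
  max (σX * expNeg (R + Rc) -
    Real.sqrt (σX ^ 2 - α * (σX ^ 2 + s ^ 2 - P) + α ^ 2 * s ^ 2)) 0 / α

/-- The inner `sup` over `α > 0` in the improved lower bound `D̲'`. -/
def DlowerPrimeFun (σX : ℝ) (R Rc : ℝ≥0∞) (P s : ℝ) : ℝ :=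
  sSup ((fun α => σX ^ 2 + s ^ 2 - 2 * σX *
    Real.sqrt ((1 - expNeg (2 * R)) * (s ^ 2 - deltaPlus σX R Rc P s α ^ 2))) '' Set.Ioi 0)

/-- The improved explicit lower bound `D̲'(R, R_c, P | W₂²)`. -/
def DlowerPrime (σX : ℝ) (R Rc : ℝ≥0∞) (P : ℝ) : ℝ :=
  sInf (DlowerPrimeFun σX R Rc P '' Set.Icc (max (σX - Real.sqrt P) 0) σX)

/-- The explicit lower bound `D̲(R, R_c, P | W₂²)` of Xie et al. -/
def DlowerW2 (σX : ℝ) (R Rc : ℝ≥0∞) (P : ℝ) : ℝ :=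
  sInf ((fun s => σX ^ 2 + s ^ 2 - 2 * σX *
      Real.sqrt ((1 - expNeg (2 * R)) *
        (s ^ 2 - max (σX * expNeg (R + Rc) - Real.sqrt P) 0 ^ 2)))
    '' Set.Icc (max (σX - Real.sqrt P) 0) σX)

end

section helpers
open Filter Topology

/-- The cdf of an atomless probability measure is continuous. -/
lemma cdf_continuous_of_noAtoms (q : Measure ℝ) [IsProbabilityMeasure q]
    (hq : ∀ x, q {x} = 0) : Continuous (cdf q) := by
  rw [continuous_iff_continuousAt]
  intro x
  rw [(monotone_cdf q).continuousAt_iff_leftLim_eq_rightLim, StieltjesFunction.rightLim_eq]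
  have h := (cdf q).measure_singleton x
  rw [measure_cdf, hq] at h
  have h2 := (monotone_cdf q).leftLim_le (le_refl x)
  have h3 : cdf q x - Function.leftLim (cdf q) x ≤ 0 := by
    simpa using h.symm
  linarith

lemma exists_cdf_eq (q : Measure ℝ) [IsProbabilityMeasure q]
    (hq : ∀ x, q {x} = 0) (u : ℝ) (hu : u ∈ Ioo (0 : ℝ) 1) : ∃ y, cdf q y = u := by
  have h1 := (tendsto_cdf_atBot q).eventually (gt_mem_nhds hu.1)
  have h2 := (tendsto_cdf_atTop q).eventually (lt_mem_nhds hu.2)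
  obtain ⟨a, ha⟩ := h1.exists
  obtain ⟨b, hb⟩ := h2.exists
  exact mem_range_of_exists_le_of_exists_ge (cdf_continuous_of_noAtoms q hq) ⟨a, ha.le⟩ ⟨b, hb.le⟩

lemma measure_cdf_le (q : Measure ℝ) [IsProbabilityMeasure q]
    (hq : ∀ x, q {x} = 0) (u : ℝ) (hu : u ∈ Ioo (0 : ℝ) 1) :
    q {y | cdf q y ≤ u} = ENNReal.ofReal u := by
  have hc := cdf_continuous_of_noAtoms q hq
  obtain ⟨y0, hy0⟩ := exists_cdf_eq q hq u hu
  obtain ⟨b, hb⟩ := ((tendsto_cdf_atTop q).eventually (lt_mem_nhds hu.2)).exists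
  have hbdd : BddAbove {y | cdf q y ≤ u} := by
    refine ⟨b, fun y hy => ?_⟩
    by_contra hlt
    push Not at hlt
    have h1 := monotone_cdf q hlt.le
    have h2 : cdf q y ≤ u := hy
    linarith
  have hne : {y | cdf q y ≤ u}.Nonempty := ⟨y0, hy0.le⟩
  have hcl : IsClosed {y | cdf q y ≤ u} := isClosed_le hc continuous_const
  have hmem := hcl.csSup_mem hne hbdd
  set s := sSup {y | cdf q y ≤ u}
  have hs : cdf q s = u := by
    apply le_antisymm hmem
    rw [← hy0]
    exact monotone_cdf q (le_csSup hbdd hy0.le)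
  have hset : {y | cdf q y ≤ u} = Iic s := by
    ext y
    constructor
    · intro hy
      exact le_csSup hbdd hy
    · intro hy
      exact (monotone_cdf q hy).trans hs.le
  rw [hset, ← ofReal_cdf, hs]

lemma ae_cdf_mem (q : Measure ℝ) [IsProbabilityMeasure q]
    (hq : ∀ x, q {x} = 0) : ∀ᵐ y ∂q, cdf q y ∈ Ioo (0 : ℝ) 1 := by
  have hm := (cdf_continuous_of_noAtoms q hq).measurable
  have key : ∀ ε ∈ Ioo (0 : ℝ) 1, q {y | cdf q y ≤ 0} ≤ ENNReal.ofReal ε ∧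
      q {y | 1 ≤ cdf q y} ≤ ENNReal.ofReal ε := by
    intro ε hε
    constructor
    · rw [← measure_cdf_le q hq ε hε]
      exact measure_mono fun y hy => le_trans hy hε.1.le
    · have h1 := measure_cdf_le q hq (1 - ε) ⟨by linarith [hε.2], by linarith [hε.1]⟩
      have h2 : q {y | 1 ≤ cdf q y} ≤ q {y | cdf q y ≤ 1 - ε}ᶜ := by
        apply measure_mono
        intro y hy
        simp only [mem_compl_iff, mem_ofPred_eq, not_le] at hy ⊢
        linarith [hε.1]
      refine h2.trans ?_
      rw [prob_compl_eq_one_sub (measurableSet_le hm measurable_const), h1,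
        ← ENNReal.ofReal_one, ← ENNReal.ofReal_sub _ (by linarith [hε.2])]
      apply le_of_eq
      congr 1
      ring
  have lim : ∀ a : ℝ≥0∞, (∀ ε ∈ Ioo (0 : ℝ) 1, a ≤ ENNReal.ofReal ε) → a = 0 := by
    intro a ha
    have ht : Tendsto (fun n : ℕ => ENNReal.ofReal (1 / ((n : ℝ) + 2))) atTop (𝓝 0) := by
      rw [← ENNReal.ofReal_zero]
      apply ENNReal.tendsto_ofReal
      have := (tendsto_one_div_add_atTop_nhds_zero_nat (𝕜 := ℝ)).comp (tendsto_add_atTop_nat 1)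
      refine this.congr fun n => ?_
      simp only [Function.comp]
      push_cast
      ring_nf
    refine le_antisymm (ge_of_tendsto' ht fun n => ha _ ⟨by positivity, ?_⟩) bot_le
    rw [div_lt_one (by positivity)]
    have : (0 : ℝ) ≤ n := Nat.cast_nonneg n
    linarith
  have h0 := lim _ fun ε hε => (key ε hε).1
  have h1 := lim _ fun ε hε => (key ε hε).2
  have h0' : ∀ᵐ y ∂q, ¬ cdf q y ≤ 0 := by rw [ae_iff]; simpa using h0
  have h1' : ∀ᵐ y ∂q, ¬ 1 ≤ cdf q y := by rw [ae_iff]; simpa using h1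
  filter_upwards [h0', h1'] with y a b
  exact ⟨not_le.1 a, not_le.1 b⟩

lemma cdf_gauss_strictMono : StrictMono (cdf (gaussianReal 0 1)) := by
  intro a b hab
  rw [cdf_eq_real, cdf_eq_real, ← Iic_union_Ioc_eq_Iic hab.le,
    measureReal_union (by
      rw [Set.disjoint_left]; intro x hx hx'; exact absurd hx (not_le.2 hx'.1)) measurableSet_Ioc]
  have : 0 < (gaussianReal 0 1).real (Ioc a b) := by
    rw [Measure.real, ENNReal.toReal_pos_iff]
    refine ⟨?_, measure_lt_top _ _⟩
    rw [pos_iff_ne_zero]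
    intro h
    have := gaussianReal_absolutelyContinuous' 0 (v := 1) one_ne_zero h
    rw [Real.volume_Ioc] at this
    simp at this
    linarith
  linarith

lemma exists_transport (q : Measure ℝ) [IsProbabilityMeasure q]
    (hq : ∀ x, q {x} = 0) : ∃ S : ℝ → ℝ, Measurable S ∧ q.map S = gaussianReal 0 1 ∧
      ∀ y, cdf q y ∈ Ioo (0 : ℝ) 1 → cdf (gaussianReal 0 1) (S y) = cdf q y := by
  classical
  have hN : ∀ x, gaussianReal 0 1 {x} = 0 := fun x =>
    gaussianReal_absolutelyContinuous 0 one_ne_zero (by simp)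
  have hm := (cdf_continuous_of_noAtoms q hq).measurable
  choose G hG using exists_cdf_eq (gaussianReal 0 1) hN
  let S : ℝ → ℝ := fun y => if h : cdf q y ∈ Ioo (0 : ℝ) 1 then G _ h else 0
  have hS : ∀ y, cdf q y ∈ Ioo (0 : ℝ) 1 → cdf (gaussianReal 0 1) (S y) = cdf q y := by
    intro y hy
    simp only [S, dif_pos hy]
    exact hG _ hy
  have hle : ∀ y x, cdf q y ∈ Ioo (0 : ℝ) 1 →
      (S y ≤ x ↔ cdf q y ≤ cdf (gaussianReal 0 1) x) := by
    intro y x hy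
    rw [← hS y hy, cdf_gauss_strictMono.le_iff_le]
  have hSm : Measurable S := by
    apply measurable_of_Iic
    intro x
    have : S ⁻¹' Iic x = ((cdf q ⁻¹' Ioo 0 1) ∩ {y | cdf q y ≤ cdf (gaussianReal 0 1) x}) ∪
        ((cdf q ⁻¹' Ioo 0 1)ᶜ ∩ {_y | 0 ≤ x}) := by
      ext y
      by_cases hy : cdf q y ∈ Ioo (0 : ℝ) 1
      · have := hle y x hy
        simp only [mem_preimage, mem_Iic, this, mem_union, mem_inter_iff, hy, mem_ofPred_eq,
          mem_compl_iff, not_true, false_and, or_false, true_and]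
      · have : S y = 0 := by simp only [S, dif_neg hy]
        simp only [mem_preimage, mem_Iic, this, mem_union, mem_inter_iff, hy, mem_ofPred_eq,
          mem_compl_iff, not_false_eq_true, false_and, false_or, true_and]
    rw [this]
    exact ((hm measurableSet_Ioo).inter (measurableSet_le hm measurable_const)).union
      ((hm measurableSet_Ioo).compl.inter (MeasurableSet.const _))
  refine ⟨S, hSm, ?_, hS⟩
  have : IsProbabilityMeasure (q.map S) := Measure.isProbabilityMeasure_map hSm.aemeasurable
  apply Measure.ext_of_Iic
  intro x
  rw [Measure.map_apply hSm measurableSet_Iic, ← ofReal_cdf]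
  have hx0 : cdf (gaussianReal 0 1) x ∈ Ioo (0 : ℝ) 1 := by
    constructor
    · exact (cdf_nonneg _ (x - 1)).trans_lt (cdf_gauss_strictMono (by linarith))
    · exact (cdf_gauss_strictMono (show x < x + 1 by linarith)).trans_le (cdf_le_one _ _)
  rw [← measure_cdf_le q hq _ hx0]
  apply measure_congr
  filter_upwards [ae_cdf_mem q hq] with y hy
  exact propext (hle y x hy)

lemma gauss_tail (a : ℝ) :
    ∫ x in Ioi a, x ∂(gaussianReal 0 1) = gaussianPDFReal 0 1 a := by
  have hd : ∀ x : ℝ, HasDerivAt (fun x => - gaussianPDFReal 0 1 x)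
      (gaussianPDFReal 0 1 x * x) x := by
    intro x
    simp only [gaussianPDFReal_def, NNReal.coe_one, mul_one, sub_zero]
    have h1 : HasDerivAt (fun x : ℝ => -x ^ 2 / 2) (-x) x := by
      have := ((hasDerivAt_pow 2 x).neg).div_const 2
      convert! this using 1
      simp
      ring
    have := ((h1.exp).const_mul ((√(2 * π))⁻¹)).neg
    convert! this using 1
    ring
  have hInteg : Integrable (fun x : ℝ => gaussianPDFReal 0 1 x * x) := by
    have := (memLp_id_gaussianReal (μ := 0) (v := 1) 1).integrable (le_refl _)
    rw [gaussianReal_of_var_ne_zero _ one_ne_zero,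
      integrable_withDensity_iff (measurable_gaussianPDF 0 1) (by simp [gaussianPDF_lt_top])] at this
    refine this.congr (ae_of_all _ fun x => ?_)
    simp [toReal_gaussianPDF, mul_comm]
  have htend : Tendsto (fun x => - gaussianPDFReal 0 1 x) atTop (𝓝 0) := by
    rw [← neg_zero]
    apply Tendsto.neg
    simp only [gaussianPDFReal_def, NNReal.coe_one, mul_one]
    rw [← mul_zero ((√(2 * π))⁻¹)]
    apply Tendsto.const_mul
    apply tendsto_exp_atBot.comp
    have := (tendsto_pow_atTop (α := ℝ) two_ne_zero).atTop_div_const (show (0:ℝ) < 2 by norm_num)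
    refine (tendsto_neg_atTop_atBot.comp this).congr fun x => ?_
    simp only [Function.comp]
    ring
  have h := integral_Ioi_of_hasDerivAt_of_tendsto' (a := a) (fun x _ => hd x) hInteg.integrableOn htend
  rw [← integral_indicator measurableSet_Ioi,
    integral_gaussianReal_eq_integral_smul one_ne_zero]
  rw [← integral_indicator measurableSet_Ioi] at h
  rw [zero_sub, neg_neg] at h
  rw [← h]
  congr 1
  ext x
  by_cases hx : x ∈ Ioi a <;> simp [hx]

lemma transport_tail (q : Measure ℝ) [IsProbabilityMeasure q] (S : ℝ → ℝ) (hSm : Measurable S)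
    (hmap : q.map S = gaussianReal 0 1)
    (hq : ∀ x, q {x} = 0)
    (hS : ∀ y, cdf q y ∈ Ioo (0 : ℝ) 1 → cdf (gaussianReal 0 1) (S y) = cdf q y)
    (y : ℝ) (hy : cdf q y ∈ Ioo (0 : ℝ) 1) :
    ∫ x in Ioi y, S x ∂q = gaussianPDFReal 0 1 (S y) := by
  rw [← gauss_tail, ← hmap, setIntegral_map measurableSet_Ioi (by fun_prop) hSm.aemeasurable]
  apply setIntegral_congr_set
  have h1 : Iic y ≤ᵐ[q] S ⁻¹' Iic (S y) := by
    filter_upwards [ae_cdf_mem q hq] with x hx hxy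
    have : cdf q x ≤ cdf q y := monotone_cdf q hxy
    rw [← hS x hx, ← hS y hy, cdf_gauss_strictMono.le_iff_le] at this
    exact this
  have h2 : q (S ⁻¹' Iic (S y)) ≤ q (Iic y) := by
    rw [← Measure.map_apply hSm measurableSet_Iic, hmap, ← ofReal_cdf, ← ofReal_cdf, hS y hy]
  have h3 := ae_eq_of_ae_subset_of_measure_ge h1 h2 measurableSet_Iic.nullMeasurableSet
    (measure_ne_top _ _)
  have h4 := h3.compl
  rw [compl_Iic, ← preimage_compl, compl_Iic] at h4
  exact h4

lemma transport_tail_nonneg (q : Measure ℝ) [IsProbabilityMeasure q] (S : ℝ → ℝ)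
    (hSm : Measurable S)
    (hmap : q.map S = gaussianReal 0 1)
    (hq : ∀ x, q {x} = 0)
    (hS : ∀ y, cdf q y ∈ Ioo (0 : ℝ) 1 → cdf (gaussianReal 0 1) (S y) = cdf q y)
    (y : ℝ) : 0 ≤ ∫ x in Ioi y, S x ∂q := by
  by_cases hy : cdf q y ∈ Ioo (0 : ℝ) 1
  · rw [transport_tail q S hSm hmap hq hS y hy]
    exact gaussianPDFReal_nonneg _ _ _
  · rcases (cdf_nonneg q y).eq_or_lt with h | h
    · have h0 : q (Iic y) = 0 := by rw [← ofReal_cdf, ← h]; simp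
      have : Ioi y =ᵐ[q] univ := by
        rw [ae_eq_univ, compl_Ioi]; exact h0
      rw [setIntegral_congr_set this, setIntegral_univ]
      have h2 := integral_map hSm.aemeasurable (μ := q) (f := fun x : ℝ => x) (by fun_prop)
      rw [← h2, hmap, integral_id_gaussianReal]
    · have h1 : cdf q y = 1 := by
        by_contra hne
        exact hy ⟨h, lt_of_le_of_ne (cdf_le_one q y) hne⟩
      have h0 : q (Ioi y) = 0 := by
        rw [← compl_Iic, prob_compl_eq_one_sub measurableSet_Iic, ← ofReal_cdf, h1]; simp
      rw [setIntegral_measure_zero _ h0]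

end helpers
section helpers2
open Filter Topology

lemma hoeffding_aux (x : ℝ) :
    Integrable (fun y : ℝ => (Iio x).indicator (fun _ => (1 : ℝ)) y
      - (Iio 0).indicator (fun _ => (1 : ℝ)) y) ∧
    ∫ y : ℝ, ((Iio x).indicator (fun _ => (1 : ℝ)) y
      - (Iio 0).indicator (fun _ => (1 : ℝ)) y) = x ∧
    ∫ y : ℝ, |(Iio x).indicator (fun _ => (1 : ℝ)) y
      - (Iio 0).indicator (fun _ => (1 : ℝ)) y| = |x| := by
  rcases le_total 0 x with hx | hx
  · have h : (fun y : ℝ => (Iio x).indicator (fun _ => (1 : ℝ)) y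
      - (Iio 0).indicator (fun _ => (1 : ℝ)) y) = (Ico 0 x).indicator (fun _ => (1 : ℝ)) := by
      ext y
      simp only [indicator_apply, mem_Iio, mem_Ico]
      split_ifs <;> grind
    have h' : (fun y : ℝ => |(Iio x).indicator (fun _ => (1 : ℝ)) y
      - (Iio 0).indicator (fun _ => (1 : ℝ)) y|) = (Ico 0 x).indicator (fun _ => (1 : ℝ)) := by
      ext y
      rw [congrFun h y, abs_of_nonneg (indicator_nonneg (by simp) y)]
    rw [h', h]
    refine ⟨(integrable_indicator_iff measurableSet_Ico).2 (by simp), ?_, ?_⟩ <;>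
      simp [integral_indicator, hx, abs_of_nonneg hx]
  · have h : (fun y : ℝ => (Iio x).indicator (fun _ => (1 : ℝ)) y
      - (Iio 0).indicator (fun _ => (1 : ℝ)) y) = (fun y => -(Ico x 0).indicator (fun _ => (1 : ℝ)) y) := by
      ext y
      simp only [indicator_apply, mem_Iio, mem_Ico]
      split_ifs <;> grind
    have h' : (fun y : ℝ => |(Iio x).indicator (fun _ => (1 : ℝ)) y
      - (Iio 0).indicator (fun _ => (1 : ℝ)) y|) = (Ico x 0).indicator (fun _ => (1 : ℝ)) := by
      ext y
      rw [congrFun h y, abs_neg, abs_of_nonneg (indicator_nonneg (by simp) y)]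
    rw [h', h]
    refine ⟨((integrable_indicator_iff measurableSet_Ico).2 (by simp)).neg, ?_, ?_⟩ <;>
      simp [integral_indicator, integral_neg, hx, abs_of_nonpos hx]

lemma hoeffding (q : Measure ℝ) [IsProbabilityMeasure q] (S : ℝ → ℝ) (hSm : Measurable S)
    (hS : Integrable S q) (hxS : Integrable (fun x => x * S x) q) (h0 : ∫ x, S x ∂q = 0) :
    Integrable (fun y => ∫ x in Ioi y, S x ∂q) ∧
      ∫ y, (∫ x in Ioi y, S x ∂q) = ∫ x, x * S x ∂q := by
  let h : ℝ × ℝ → ℝ := fun z => S z.1 * ((Iio z.1).indicator (fun _ => (1 : ℝ)) z.2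
      - (Iio 0).indicator (fun _ => (1 : ℝ)) z.2)
  have hm : Measurable h := by
    apply (hSm.comp measurable_fst).mul
    apply Measurable.sub
    · have : (fun z : ℝ × ℝ => (Iio z.1).indicator (fun _ => (1 : ℝ)) z.2) =
          {z : ℝ × ℝ | z.2 < z.1}.indicator (fun _ => (1 : ℝ)) := by
        ext z; simp [indicator_apply]
      rw [this]
      exact measurable_const.indicator (measurableSet_lt measurable_snd measurable_fst)
    · exact (measurable_const.indicator measurableSet_Iio).comp measurable_snd
  have hInteg : Integrable h (q.prod volume) := by
    rw [integrable_prod_iff hm.aestronglyMeasurable]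
    refine ⟨ae_of_all _ fun x => (hoeffding_aux x).1.const_mul (S x), ?_⟩
    refine hxS.norm.congr (ae_of_all _ fun x => ?_)
    simp only [h, norm_mul, Real.norm_eq_abs]
    rw [integral_const_mul, (hoeffding_aux x).2.2, mul_comm]
  have hk : ∀ y, ∫ x, h (x, y) ∂q = ∫ x in Ioi y, S x ∂q := by
    intro y
    have : ∀ x, h (x, y) = (Ioi y).indicator S x -
        (Iio 0).indicator (fun _ => (1 : ℝ)) y * S x := by
      intro x
      simp only [h, indicator_apply, mem_Iio, mem_Ioi]
      split_ifs <;> ring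
    simp_rw [this]
    rw [integral_sub (hS.indicator measurableSet_Ioi) (hS.const_mul _), integral_const_mul, h0,
      mul_zero, sub_zero, integral_indicator measurableSet_Ioi]
  constructor
  · refine hInteg.integral_prod_right.congr (ae_of_all _ fun y => hk y)
  · simp_rw [← hk]
    rw [← integral_integral_swap (f := fun x y => h (x, y)) hInteg]
    apply integral_congr_ae
    refine ae_of_all _ fun x => ?_
    simp only [h]
    rw [integral_const_mul, (hoeffding_aux x).2.1, mul_comm]

lemma log_gaussianPDFReal (m : ℝ) (v : ℝ≥0) (hv : v ≠ 0) (x : ℝ) :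
    Real.log (gaussianPDFReal m v x) = - (1 / 2) * Real.log (2 * π * v) - (x - m) ^ 2 / (2 * v) := by
  have hv' : (0 : ℝ) < v := by positivity
  rw [gaussianPDFReal_def, Real.log_mul (by positivity) (exp_ne_zero _), Real.log_exp,
    Real.log_inv, Real.log_sqrt (by positivity)]
  ring

lemma gauss_second_moment : ∫ x, x ^ 2 ∂(gaussianReal 0 1) = 1 := by
  have h := variance_fun_id_gaussianReal (μ := 0) (v := 1)
  rw [variance_of_integral_eq_zero (by fun_prop) (by simp)] at h
  simpa using h

lemma gauss_coupling (q : Measure ℝ) [IsProbabilityMeasure q] (f : ℝ → ℝ≥0∞)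
    (hfm : Measurable f) (hqf : q = volume.withDensity f)
    (hlog : Integrable (fun y => Real.log (f y).toReal) q) (hL2 : MemLp id 2 q) :
    ∃ S : ℝ → ℝ, Measurable S ∧ q.map S = gaussianReal 0 1 ∧
      Real.exp (- (1 / 2) * Real.log (2 * π) - 1 / 2 - ∫ y, Real.log (f y).toReal ∂q) ≤
        ∫ y, y * S y ∂q := by
  have hac : q ≪ volume := by rw [hqf]; exact withDensity_absolutelyContinuous _ _
  have hq : ∀ x, q {x} = 0 := fun x => hac (by simp)
  obtain ⟨S, hSm, hmap, hS⟩ := exists_transport q hq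
  refine ⟨S, hSm, hmap, ?_⟩
  have hS2 : MemLp S 2 q := by
    have := memLp_id_gaussianReal (μ := 0) (v := 1) 2
    rw [← hmap] at this
    exact (memLp_map_measure_iff (by fun_prop) hSm.aemeasurable).1 this
  have hS0 : ∫ x, S x ∂q = 0 := by
    have h2 := integral_map hSm.aemeasurable (μ := q) (f := fun x : ℝ => x) (by fun_prop)
    rw [← h2, hmap, integral_id_gaussianReal]
  have hSsq : ∫ x, S x ^ 2 ∂q = 1 := by
    have h2 := integral_map hSm.aemeasurable (μ := q) (f := fun x : ℝ => x ^ 2) (by fun_prop)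
    rw [← h2, hmap, gauss_second_moment]
  have hSi : Integrable S q := hS2.integrable (by norm_num)
  have hxS : Integrable (fun x => x * S x) q := hL2.integrable_mul hS2
  obtain ⟨hki, hkeq⟩ := hoeffding q S hSm hSi hxS hS0
  set k : ℝ → ℝ := fun y => ∫ x in Ioi y, S x ∂q with hk
  have hk0 : ∀ y, 0 ≤ k y := transport_tail_nonneg q S hSm hmap hq hS
  have hkS : ∀ᵐ y ∂q, k y = gaussianPDFReal 0 1 (S y) := by
    filter_upwards [ae_cdf_mem q hq] with y hy using transport_tail q S hSm hmap hq hS y hy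
  have hf0 : ∀ᵐ y ∂q, f y ≠ 0 := by
    rw [hqf, ae_withDensity_iff hfm]
    exact ae_of_all _ fun _ h => h
  have hftop : ∀ᵐ y ∂q, f y ≠ ⊤ := by
    apply hac.ae_le
    refine (ae_lt_top hfm ?_).mono fun _ h => h.ne
    have : q univ = 1 := measure_univ
    rw [hqf, withDensity_apply _ MeasurableSet.univ, setLIntegral_univ] at this
    rw [this]; simp
  let w : ℝ → ℝ := fun y => k y / (f y).toReal
  have hw0 : ∀ y, 0 ≤ w y := fun y => div_nonneg (hk0 y) ENNReal.toReal_nonneg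
  have hwm : AEStronglyMeasurable w q := by
    have : AEStronglyMeasurable k q := hki.1.mono_ac hac
    exact this.div₀ hfm.ennreal_toReal.aestronglyMeasurable
  have hlw : ∀ᵐ y ∂q, Real.log (w y) = (- (1 / 2) * Real.log (2 * π) - S y ^ 2 / 2)
      - Real.log (f y).toReal ∧ 0 < w y := by
    filter_upwards [hkS, hf0, hftop] with y h1 h2 h3
    have hfp : 0 < (f y).toReal := ENNReal.toReal_pos h2 h3
    have hkp : 0 < k y := by rw [h1]; exact gaussianPDFReal_pos _ _ _ one_ne_zero
    refine ⟨?_, div_pos hkp hfp⟩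
    simp only [w]
    rw [Real.log_div hkp.ne' hfp.ne', h1, log_gaussianPDFReal _ _ one_ne_zero]
    simp
  have hle : ∫⁻ y, ENNReal.ofReal (w y) ∂q ≤ ENNReal.ofReal (∫ y, k y) := by
    rw [ofReal_integral_eq_lintegral_ofReal hki (ae_of_all _ hk0)]
    have hwm' : AEMeasurable (fun y => ENNReal.ofReal (w y)) (volume.withDensity f) := by
      rw [← hqf]; exact hwm.aemeasurable.ennreal_ofReal
    calc ∫⁻ y, ENNReal.ofReal (w y) ∂q
        = ∫⁻ y, ENNReal.ofReal (w y) ∂(volume.withDensity f) := by rw [← hqf]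
      _ ≤ ∫⁻ y, (f * fun y => ENNReal.ofReal (w y)) y := by
          exact lintegral_withDensity_le_lintegral_mul _ hfm _
      _ ≤ ∫⁻ y, ENNReal.ofReal (k y) := by
          apply lintegral_mono_ae
          have hft : ∀ᵐ y, f y ≠ ⊤ := by
            refine (ae_lt_top hfm ?_).mono fun _ h => h.ne
            have : q univ = 1 := measure_univ
            rw [hqf, withDensity_apply _ MeasurableSet.univ, setLIntegral_univ] at this
            rw [this]; simp
          filter_upwards [hft] with y hy
          simp only [Pi.mul_apply, w]
          by_cases h0 : f y = 0
          · simp [h0]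
          · have hfp : 0 < (f y).toReal := ENNReal.toReal_pos h0 hy
            rw [ENNReal.ofReal_div_of_pos hfp, ENNReal.ofReal_toReal hy,
              ENNReal.mul_div_cancel h0 hy]
  have hwi : Integrable w q := by
    refine ⟨hwm, ?_⟩
    rw [hasFiniteIntegral_iff_ofReal (ae_of_all _ hw0)]
    exact hle.trans_lt ENNReal.ofReal_lt_top
  have hwle : ∫ y, w y ∂q ≤ ∫ y, k y := by
    rw [← ofReal_integral_eq_lintegral_ofReal hwi (ae_of_all _ hw0)] at hle
    exact (ENNReal.ofReal_le_ofReal_iff (integral_nonneg hk0)).1 hle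
  have hS2i : Integrable (fun y => S y ^ 2) q := hS2.integrable_sq
  have hi1 : Integrable (fun y => - (1 / 2) * Real.log (2 * π) - S y ^ 2 / 2) q :=
    (integrable_const _).sub (hS2i.div_const 2)
  have hlwi : Integrable (fun y => Real.log (w y)) q :=
    (hi1.sub hlog).congr (hlw.mono fun y hy => hy.1.symm)
  have hlwe : ∫ y, Real.log (w y) ∂q =
      - (1 / 2) * Real.log (2 * π) - 1 / 2 - ∫ y, Real.log (f y).toReal ∂q := by
    rw [integral_congr_ae (hlw.mono fun y hy => hy.1), integral_sub hi1 hlog,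
      integral_sub (integrable_const _) (hS2i.div_const 2), integral_div, hSsq]
    simp
  rw [← hlwe, ← hkeq]
  refine le_trans ?_ hwle
  set c := ∫ y, Real.log (w y) ∂q
  have hj : ∫ y, Real.exp c * (1 + (Real.log (w y) - c)) ∂q ≤ ∫ y, w y ∂q := by
    have hI : Integrable (fun y => Real.exp c * (1 + (Real.log (w y) - c))) q :=
      ((integrable_const _).add (hlwi.sub (integrable_const _))).const_mul _
    apply integral_mono_ae hI hwi
    filter_upwards [hlw] with y hy
    have h1 : Real.exp c * Real.exp (Real.log (w y) - c) = w y := by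
      rw [← Real.exp_add, add_sub_cancel, Real.exp_log hy.2]
    have h2 := Real.add_one_le_exp (Real.log (w y) - c)
    have h3 := mul_le_mul_of_nonneg_left h2 (Real.exp_pos c).le
    linarith
  have he : ∫ y, Real.exp c * (1 + (Real.log (w y) - c)) ∂q = Real.exp c := by
    have hsub : Integrable (fun y => Real.log (w y) - c) q := hlwi.sub (integrable_const _)
    rw [integral_const_mul, integral_add (integrable_const _) hsub,
      integral_sub hlwi (integrable_const _)]
    simp [c]
  rw [← he]
  exact hj

end helpers2
section helpers3
open Filter Topology

lemma KLD_map_le {α β : Type*} [MeasurableSpace α] [MeasurableSpace β] (e : α ≃ᵐ β)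
    (q p : Measure α) [IsProbabilityMeasure q] [IsProbabilityMeasure p] :
    KLD (q.map e) (p.map e) ≤ KLD q p := by
  unfold KLD
  by_cases h : q ≪ p ∧ Integrable (fun x => Real.log (q.rnDeriv p x).toReal) q
  · have hae : (fun x ↦ Real.log ((q.map e).rnDeriv (p.map e) (e x)).toReal) =ᵐ[q]
        fun x => Real.log (q.rnDeriv p x).toReal := by
      filter_upwards [h.1.ae_le (e.measurableEmbedding.rnDeriv_map q p)] with x hx
      rw [hx]
    have h' : q.map e ≪ p.map e ∧
        Integrable (fun x => Real.log ((q.map e).rnDeriv (p.map e) x).toReal) (q.map e) := by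
      refine ⟨h.1.map e.measurable, ?_⟩
      rw [e.measurableEmbedding.integrable_map_iff]
      exact h.2.congr hae.symm
    rw [if_pos h, if_pos h', e.measurableEmbedding.integral_map, integral_congr_ae hae]
  · rw [if_neg h]
    exact le_top

lemma W2sq_le {Ω : Type*} [MeasurableSpace Ω] (ρ : Measure Ω) [IsProbabilityMeasure ρ]
    (U V : Ω → ℝ) (hU : Measurable U) (hV : Measurable V) :
    W2sq (ρ.map U) (ρ.map V) ≤ ∫⁻ w, ENNReal.ofReal ((U w - V w) ^ 2) ∂ρ := by
  have hm : Measurable fun w => (U w, V w) := hU.prodMk hV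
  have h1 : IsProbabilityMeasure (ρ.map fun w => (U w, V w)) :=
    Measure.isProbabilityMeasure_map hm.aemeasurable
  have h2 : (ρ.map fun w => (U w, V w)).map Prod.fst = ρ.map U := by
    rw [Measure.map_map measurable_fst hm]; rfl
  have h3 : (ρ.map fun w => (U w, V w)).map Prod.snd = ρ.map V := by
    rw [Measure.map_map measurable_snd hm]; rfl
  unfold W2sq
  refine iInf_le_of_le (ρ.map fun w => (U w, V w)) (iInf_le_of_le h1 (iInf_le_of_le h2
    (iInf_le_of_le h3 ?_)))
  rw [lintegral_map (by fun_prop) hm]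

lemma sq_cost {Ω : Type*} [MeasurableSpace Ω] (ρ : Measure Ω) [IsProbabilityMeasure ρ]
    (A B : Ω → ℝ) (hA : MemLp A 2 ρ) (hB : MemLp B 2 ρ) (a : ℝ) :
    ∫ w, (A w - a * B w) ^ 2 ∂ρ =
        (∫ w, A w ^ 2 ∂ρ) - 2 * a * (∫ w, A w * B w ∂ρ) + a ^ 2 * ∫ w, B w ^ 2 ∂ρ ∧
    ∫⁻ w, ENNReal.ofReal ((A w - a * B w) ^ 2) ∂ρ = ENNReal.ofReal (
        (∫ w, A w ^ 2 ∂ρ) - 2 * a * (∫ w, A w * B w ∂ρ) + a ^ 2 * ∫ w, B w ^ 2 ∂ρ) := by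
  have hAB : Integrable (fun w => A w * B w) ρ := hA.integrable_mul hB
  have hi : Integrable (fun w => (A w - a * B w) ^ 2) ρ := (hA.sub (hB.const_mul a)).integrable_sq
  have h1 : ∫ w, (A w - a * B w) ^ 2 ∂ρ =
        (∫ w, A w ^ 2 ∂ρ) - 2 * a * (∫ w, A w * B w ∂ρ) + a ^ 2 * ∫ w, B w ^ 2 ∂ρ := by
    have : ∀ w, (A w - a * B w) ^ 2 = (A w ^ 2 - 2 * a * (A w * B w)) + a ^ 2 * B w ^ 2 := by
      intro w; ring
    simp_rw [this]
    have h3 : Integrable (fun w => A w ^ 2 - 2 * a * (A w * B w)) ρ :=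
      hA.integrable_sq.sub (hAB.const_mul _)
    rw [integral_add h3 (hB.integrable_sq.const_mul _), integral_sub hA.integrable_sq
      (hAB.const_mul _), integral_const_mul, integral_const_mul]
  refine ⟨h1, ?_⟩
  rw [← h1, ofReal_integral_eq_lintegral_ofReal hi (ae_of_all _ fun w => sq_nonneg _)]

lemma gauss_eq (μX σX : ℝ) : gauss μX σX = gaussianReal μX (NNReal.mk (σX ^ 2) (sq_nonneg σX)) :=
  rfl

instance gauss_isProb (μX σX : ℝ) : IsProbabilityMeasure (gauss μX σX) := by
  rw [gauss_eq]; infer_instance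

lemma gauss_mean (μX σX : ℝ) : ∫ x, x ∂(gauss μX σX) = μX := by
  rw [gauss_eq, integral_id_gaussianReal]

lemma gauss_memLp (μX σX : ℝ) : MemLp id 2 (gauss μX σX) := by
  rw [gauss_eq]; exact memLp_id_gaussianReal 2

lemma gauss_var (μX σX : ℝ) : ∫ x, (x - μX) ^ 2 ∂(gauss μX σX) = σX ^ 2 := by
  have h := variance_fun_id_gaussianReal (μ := μX) (v := NNReal.mk (σX ^ 2) (sq_nonneg σX))
  rw [variance_eq_integral (by fun_prop), integral_id_gaussianReal] at h
  rw [gauss_eq, h]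
  rfl

lemma integral_sub_const_sq (q : Measure ℝ) [IsProbabilityMeasure q] (hL2 : MemLp id 2 q) (c : ℝ) :
    ∫ y, (y - c) ^ 2 ∂q = (∫ y, (y - ∫ x, x ∂q) ^ 2 ∂q) + ((∫ x, x ∂q) - c) ^ 2 := by
  set m := ∫ x, x ∂q
  have hi : Integrable (fun y : ℝ => y) q := hL2.integrable (by norm_num)
  have h2 : Integrable (fun y : ℝ => (y - m) ^ 2) q := (hL2.sub (memLp_const m)).integrable_sq
  have : ∀ y : ℝ, (y - c) ^ 2 = (y - m) ^ 2 + (2 * (m - c) * (y - m) + (m - c) ^ 2) := by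
    intro y; ring
  rw [integral_congr_ae (ae_of_all _ this)]
  have hi' : Integrable (fun y : ℝ => y - m) q := hi.sub (integrable_const _)
  have h3 : Integrable (fun y : ℝ => 2 * (m - c) * (y - m) + (m - c) ^ 2) q :=
    (hi'.const_mul _).add (integrable_const _)
  rw [integral_add h2 h3, integral_add (hi'.const_mul _) (integrable_const _), integral_const_mul,
    integral_sub hi (integrable_const _)]
  simp [m]

/-- Coupling with the correlation lower bound coming from the KL divergence. -/
lemma kl_coupling (μX σX : ℝ) (hσX : 0 < σX) (q : Measure ℝ) [IsProbabilityMeasure q]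
    (hL2 : MemLp id 2 q) (P : ℝ≥0∞) (hP : P ≠ ⊤) (hKL : KLD q (gauss μX σX) ≤ P) :
    ∃ S : ℝ → ℝ, Measurable S ∧ q.map S = gaussianReal 0 1 ∧
      σX * (expNeg P * Real.exp (((∫ y, (y - ∫ x, x ∂q) ^ 2 ∂q) / σX ^ 2 - 1) / 2)) ≤
        ∫ y, y * S y ∂q := by
  set v : ℝ≥0 := NNReal.mk (σX ^ 2) (sq_nonneg σX) with hv
  have hvc : (v : ℝ) = σX ^ 2 := rfl
  have hv0 : v ≠ 0 := by
    intro h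
    have : (v : ℝ) = 0 := by rw [h]; rfl
    rw [hvc] at this
    exact (pow_pos hσX 2).ne' this
  set m := ∫ x, x ∂q with hm
  set s2 := ∫ y, (y - m) ^ 2 ∂q with hs2
  have hg : gauss μX σX = gaussianReal μX v := rfl
  rw [hg] at hKL
  unfold KLD at hKL
  split_ifs at hKL with hc
  swap
  · exact absurd (top_le_iff.1 hKL) hP
  obtain ⟨hac, hli⟩ := hc
  set r := q.rnDeriv (gaussianReal μX v) with hr
  have hrm : Measurable r := Measure.measurable_rnDeriv _ _
  have hK : ∫ x, Real.log (r x).toReal ∂q ≤ P.toReal := by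
    have := ENNReal.toReal_mono hP hKL
    exact (ENNReal.ofReal_le_iff_le_toReal hP).1 hKL
  have hqf : q = volume.withDensity (gaussianPDF μX v * r) := by
    rw [withDensity_mul _ (measurable_gaussianPDF μX v) hrm,
      ← gaussianReal_of_var_ne_zero _ hv0]
    exact (Measure.withDensity_rnDeriv_eq _ _ hac).symm
  have hlf : (fun y => Real.log ((gaussianPDF μX v * r) y).toReal) =ᵐ[q]
      fun y => Real.log (r y).toReal +
        (- (1 / 2) * Real.log (2 * π * v) - (y - μX) ^ 2 / (2 * v)) := by
    filter_upwards [Measure.rnDeriv_pos hac, hac.ae_le (Measure.rnDeriv_ne_top q _)] with y h1 h2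
    have hrp : 0 < (r y).toReal := ENNReal.toReal_pos h1.ne' h2
    rw [Pi.mul_apply, ENNReal.toReal_mul, toReal_gaussianPDF,
      Real.log_mul (gaussianPDFReal_pos _ _ _ hv0).ne' hrp.ne', log_gaussianPDFReal _ _ hv0]
    ring
  have hsq : Integrable (fun y : ℝ => (y - μX) ^ 2) q := (hL2.sub (memLp_const μX)).integrable_sq
  have hi2 : Integrable (fun y : ℝ => - (1 / 2) * Real.log (2 * π * v) - (y - μX) ^ 2 / (2 * v)) q :=
    (integrable_const _).sub (hsq.div_const _)
  obtain ⟨S, hSm, hmap, hS⟩ := gauss_coupling q _ ((measurable_gaussianPDF μX v).mul hrm) hqf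
    ((hli.add hi2).congr hlf.symm) hL2
  refine ⟨S, hSm, hmap, le_trans ?_ hS⟩
  rw [integral_congr_ae hlf, integral_add hli hi2, integral_sub (integrable_const _)
    (hsq.div_const _), integral_div, integral_sub_const_sq q hL2, ← hm, ← hs2]
  simp only [integral_const, probReal_univ, one_smul, hvc]
  rw [expNeg, if_neg hP]
  nth_rewrite 1 [← Real.exp_log hσX]
  rw [← Real.exp_add, ← Real.exp_add]
  apply Real.exp_le_exp.2
  have hl : Real.log (2 * π * σX ^ 2) = Real.log (2 * π) + 2 * Real.log σX := by
    rw [Real.log_mul (by positivity) (by positivity), Real.log_pow]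
    simp
  rw [hl]
  have h1 : (s2 + (m - μX) ^ 2) / (2 * σX ^ 2) = s2 / σX ^ 2 / 2 + (m - μX) ^ 2 / (2 * σX ^ 2) := by
    field_simp
  have h2 : 0 ≤ (m - μX) ^ 2 / (2 * σX ^ 2) := by positivity
  rw [h1]
  linarith

/-- The scaling factor of the reconstruction. -/
noncomputable def scaleFac (σX s2 : ℝ) : ℝ := if s2 ≤ σX ^ 2 then 1 else σX / Real.sqrt s2

lemma scaleFac_pos (σX s2 : ℝ) (hσX : 0 < σX) : 0 < scaleFac σX s2 := by
  unfold scaleFac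
  split_ifs with h
  · exact one_pos
  · have : 0 < s2 := lt_trans (by positivity) (not_le.1 h)
    positivity

lemma scaleFac_sq (σX s2 : ℝ) (hσX : 0 < σX) : scaleFac σX s2 ^ 2 * s2 ≤ σX ^ 2 := by
  unfold scaleFac
  split_ifs with h
  · simpa using h
  · have : 0 < s2 := lt_trans (by positivity) (not_le.1 h)
    rw [div_pow, Real.sq_sqrt this.le, div_mul_cancel₀ _ this.ne']

lemma expNeg_nonneg (P : ℝ≥0∞) : 0 ≤ expNeg P := by
  unfold expNeg; split_ifs <;> positivity

lemma expNeg_le_one (P : ℝ≥0∞) : expNeg P ≤ 1 := by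
  unfold expNeg
  split_ifs
  · norm_num
  · exact Real.exp_le_one_iff.2 (by simp)

lemma scale_bound (σX s2 k E : ℝ) (hσX : 0 < σX) (hk0 : 0 ≤ k) (hk1 : k ≤ 1)
    (hE : σX * (k * Real.exp ((s2 / σX ^ 2 - 1) / 2)) ≤ E) :
    σX ^ 2 - 2 * scaleFac σX s2 * (σX * E) + scaleFac σX s2 ^ 2 * s2 ≤ 2 * σX ^ 2 * (1 - k) := by
  unfold scaleFac
  split_ifs with h
  · set v := (s2 / σX ^ 2 - 1) / 2 with hv
    have hs : s2 = σX ^ 2 * (2 * v + 1) := by rw [hv]; field_simp; ring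
    have hv0 : v ≤ 0 := by
      have : s2 / σX ^ 2 ≤ 1 := (div_le_one (by positivity)).2 h
      rw [hv]; linarith
    have h1 := Real.add_one_le_exp v
    have h2 : σX * (k * (v + 1)) ≤ E :=
      le_trans (by gcongr) hE
    have h3 : σX ^ 2 * (k * (v + 1)) ≤ σX * E := by nlinarith
    have h4 : 0 ≤ σX ^ 2 * ((1 - k) * (-v)) :=
      mul_nonneg (by positivity) (mul_nonneg (by linarith) (by linarith))
    rw [hs]
    nlinarith
  · have hs0 : 0 < s2 := lt_trans (by positivity) (not_le.1 h)
    have hr : 0 < Real.sqrt s2 := Real.sqrt_pos.2 hs0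
    rw [div_pow, Real.sq_sqrt hs0.le, div_mul_cancel₀ _ hs0.ne']
    have h1 : Real.sqrt s2 ≤ σX * Real.exp ((s2 / σX ^ 2 - 1) / 2) := by
      rw [Real.sqrt_le_left (by positivity), mul_pow, ← Real.exp_nat_mul]
      have := Real.add_one_le_exp (s2 / σX ^ 2 - 1)
      have h2 : s2 / σX ^ 2 ≤ Real.exp (((2 : ℕ) : ℝ) * ((s2 / σX ^ 2 - 1) / 2)) := by
        have e : ((2 : ℕ) : ℝ) * ((s2 / σX ^ 2 - 1) / 2) = s2 / σX ^ 2 - 1 := by push_cast; ring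
        rw [e]; linarith
      rw [div_le_iff₀ (by positivity)] at h2
      linarith
    have h2 : k * Real.sqrt s2 ≤ E := by
      calc k * Real.sqrt s2 ≤ k * (σX * Real.exp ((s2 / σX ^ 2 - 1) / 2)) := by gcongr
        _ = σX * (k * Real.exp ((s2 / σX ^ 2 - 1) / 2)) := by ring
        _ ≤ E := hE
    have h3 : k ≤ E / Real.sqrt s2 := (le_div_iff₀ hr).2 h2
    have h4 : 2 * (σX / Real.sqrt s2) * (σX * E) = 2 * σX ^ 2 * (E / Real.sqrt s2) := by
      field_simp
    rw [h4]
    have : 2 * σX ^ 2 * k ≤ 2 * σX ^ 2 * (E / Real.sqrt s2) := by gcongr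
    linarith

lemma perception (μX σX : ℝ) (hσX : 0 < σX) (q : Measure ℝ) [IsProbabilityMeasure q]
    (hL2 : MemLp id 2 q) (P : ℝ≥0∞) (hKL : KLD q (gauss μX σX) ≤ P) :
    W2sq (gauss μX σX) (q.map fun y => scaleFac σX (∫ y, (y - ∫ x, x ∂q) ^ 2 ∂q) *
      (y - ∫ x, x ∂q) + μX) ≤ ENNReal.ofReal (2 * σX ^ 2 * (1 - expNeg P)) := by
  have hpm : IsProbabilityMeasure (gauss μX σX) := gauss_isProb μX σX
  set m := ∫ x, x ∂q with hm
  set s2 := ∫ y, (y - m) ^ 2 ∂q with hs2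
  set a := scaleFac σX s2 with ha
  have hB : MemLp (fun y : ℝ => y - m) 2 q := hL2.sub (memLp_const m)
  by_cases hP : P = ⊤
  · set p := gauss μX σX
    have hA : MemLp (fun x : ℝ => x - μX) 2 p :=
      (gauss_memLp μX σX).sub (memLp_const μX)
    have hfst : (p.prod q).map Prod.fst = p := by simp
    have hsnd : (p.prod q).map Prod.snd = q := by simp
    have hA' : MemLp (fun w : ℝ × ℝ => w.1 - μX) 2 (p.prod q) := by
      rw [← hfst] at hA
      exact (memLp_map_measure_iff (by fun_prop) (by fun_prop)).1 hA
    have hB' : MemLp (fun w : ℝ × ℝ => w.2 - m) 2 (p.prod q) := by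
      have hB2 := hB
      rw [← hsnd] at hB2
      exact (memLp_map_measure_iff (by fun_prop) (by fun_prop)).1 hB2
    have hA2 : ∫ w : ℝ × ℝ, (w.1 - μX) ^ 2 ∂(p.prod q) = σX ^ 2 := by
      have := integral_map (μ := p.prod q) (φ := Prod.fst) (by fun_prop)
        (f := fun x : ℝ => (x - μX) ^ 2) (by fun_prop)
      rw [← this, hfst, gauss_var]
    have hB2 : ∫ w : ℝ × ℝ, (w.2 - m) ^ 2 ∂(p.prod q) = s2 := by
      have := integral_map (μ := p.prod q) (φ := Prod.snd) (by fun_prop)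
        (f := fun x : ℝ => (x - m) ^ 2) (by fun_prop)
      rw [← this, hsnd]
    have hAB : ∫ w : ℝ × ℝ, (w.1 - μX) * (w.2 - m) ∂(p.prod q) = 0 := by
      rw [integral_prod_mul (fun x : ℝ => x - μX) (fun y : ℝ => y - m)]
      have : ∫ y, (y - m) ∂q = 0 := by
        have hi : Integrable (fun y : ℝ => y) q := hL2.integrable (by norm_num)
        rw [integral_sub hi (integrable_const _)]
        simp [hm]
      rw [this, mul_zero]
    have h := W2sq_le (p.prod q) Prod.fst (fun w => a * (w.2 - m) + μX) (by fun_prop) (by fun_prop)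
    have hmm : (p.prod q).map (fun w => a * (w.2 - m) + μX) = q.map fun y => a * (y - m) + μX := by
      conv_rhs => rw [← hsnd]
      rw [Measure.map_map (by fun_prop) (by fun_prop)]
      rfl
    rw [hfst, hmm] at h
    refine h.trans ?_
    have hc := (sq_cost (p.prod q) _ _ hA' hB' a).2
    rw [hA2, hB2, hAB] at hc
    have he : ∀ w : ℝ × ℝ, (w.1 - (a * (w.2 - m) + μX)) ^ 2 = ((w.1 - μX) - a * (w.2 - m)) ^ 2 := by
      intro w; ring
    simp_rw [he]
    rw [hc]
    apply ENNReal.ofReal_le_ofReal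
    have := scaleFac_sq σX s2 hσX
    rw [hP, expNeg, if_pos rfl]
    linarith
  · obtain ⟨S, hSm, hmap, hS⟩ := kl_coupling μX σX hσX q hL2 P hP hKL
    rw [← hm, ← hs2] at hS
    have hS2 : MemLp S 2 q := by
      have := memLp_id_gaussianReal (μ := 0) (v := 1) 2
      rw [← hmap] at this
      exact (memLp_map_measure_iff (by fun_prop) hSm.aemeasurable).1 this
    have hS0 : ∫ x, S x ∂q = 0 := by
      have h2 := integral_map hSm.aemeasurable (μ := q) (f := fun x : ℝ => x) (by fun_prop)
      rw [← h2, hmap, integral_id_gaussianReal]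
    have hSsq : ∫ x, S x ^ 2 ∂q = 1 := by
      have h2 := integral_map hSm.aemeasurable (μ := q) (f := fun x : ℝ => x ^ 2) (by fun_prop)
      rw [← h2, hmap, gauss_second_moment]
    have hU : q.map (fun y => σX * S y + μX) = gauss μX σX := by
      have h1 : (q.map S).map (fun x => σX * x) =
          gaussianReal 0 (NNReal.mk (σX ^ 2) (sq_nonneg σX)) := by
        rw [hmap, gaussianReal_map_const_mul]
        simp
      have h2 : ((q.map S).map (fun x => σX * x)).map (fun x => x + μX) = gauss μX σX := by
        rw [h1, gaussianReal_map_add_const, zero_add]; rfl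
      rw [← h2, Measure.map_map (by fun_prop) hSm, Measure.map_map (by fun_prop) (by fun_prop)]
      rfl
    have h := W2sq_le q (fun y => σX * S y + μX) (fun y => a * (y - m) + μX) (by fun_prop)
      (by fun_prop)
    rw [hU] at h
    refine h.trans ?_
    have hc := (sq_cost q _ _ (hS2.const_mul σX) hB a).2
    have he : ∀ y : ℝ, (σX * S y + μX - (a * (y - m) + μX)) ^ 2 = (σX * S y - a * (y - m)) ^ 2 := by
      intro w; ring
    simp_rw [he]
    rw [hc]
    apply ENNReal.ofReal_le_ofReal
    have e1 : ∫ y, (σX * S y) ^ 2 ∂q = σX ^ 2 := by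
      simp_rw [mul_pow]
      rw [integral_const_mul, hSsq, mul_one]
    have e2 : ∫ y, (σX * S y) * (y - m) ∂q = σX * ∫ y, y * S y ∂q := by
      have : ∀ y, (σX * S y) * (y - m) = σX * (y * S y) - σX * m * S y := by intro y; ring
      simp_rw [this]
      have hxS : Integrable (fun x => x * S x) q := hL2.integrable_mul hS2
      rw [integral_sub (hxS.const_mul _) ((hS2.integrable (by norm_num)).const_mul _),
        integral_const_mul, integral_const_mul, hS0]
      ring
    rw [e1, e2, ← hs2]
    exact scale_bound σX s2 _ _ hσX (expNeg_nonneg P) (expNeg_le_one P) hS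

lemma distortion_alg (σX s2 C d : ℝ) (hσX : 0 < σX) 
    (hC : 0 < s2 → 0 ≤ σX ^ 2 - 2 * (σX / Real.sqrt s2) * C + (σX / Real.sqrt s2) ^ 2 * s2) :
    σX ^ 2 - 2 * scaleFac σX s2 * C + scaleFac σX s2 ^ 2 * s2 ≤
      σX ^ 2 - 2 * 1 * C + 1 ^ 2 * s2 + d ^ 2 := by
  unfold scaleFac
  split_ifs with h
  · nlinarith [sq_nonneg d]
  · have hs0 : 0 < s2 := lt_trans (by positivity) (not_le.1 h)
    have hr : 0 < Real.sqrt s2 := Real.sqrt_pos.2 hs0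
    have hC := hC hs0
    rw [div_pow, Real.sq_sqrt hs0.le, div_mul_cancel₀ _ hs0.ne'] at hC ⊢
    set r := Real.sqrt s2 with hrdef
    have hrs : s2 = r ^ 2 := (Real.sq_sqrt hs0.le).symm
    have hlt : σX < r := by
      rw [hrs] at h
      exact lt_of_pow_lt_pow_left₀ 2 hr.le (not_le.1 h)
    set D := C / r with hD
    have hCD : C = D * r := by rw [hD]; field_simp
    have e : 2 * (σX / r) * C = 2 * σX * D := by rw [hD]; field_simp
    rw [e] at hC ⊢
    have hD' : D ≤ σX := by nlinarith
    rw [hrs, hCD]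
    nlinarith [sq_nonneg d, mul_nonneg (sub_nonneg.2 hlt.le) (sub_nonneg.2 hD'),
      sq_nonneg (r - σX)]

lemma distortion_le (μX σX : ℝ) (hσX : 0 < σX) {Ω : Type*} [MeasurableSpace Ω] (ρ : Measure Ω)
    [IsProbabilityMeasure ρ] (X Y : Ω → ℝ) (hXm : Measurable X) (hY : Measurable Y)
    (hX : ρ.map X = gauss μX σX) (hXL : MemLp X 2 ρ) (hYL : MemLp Y 2 ρ) (m s2 : ℝ)
    (hm : m = ∫ w, Y w ∂ρ) (hs2 : s2 = ∫ w, (Y w - m) ^ 2 ∂ρ) :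
    ∫⁻ w, ENNReal.ofReal ((X w - (scaleFac σX s2 * (Y w - m) + μX)) ^ 2) ∂ρ ≤
      ∫⁻ w, ENNReal.ofReal ((X w - Y w) ^ 2) ∂ρ := by
  have hA : MemLp (fun w => X w - μX) 2 ρ := hXL.sub (memLp_const _)
  have hB : MemLp (fun w => Y w - m) 2 ρ := hYL.sub (memLp_const _)
  have hA0 : ∫ w, (X w - μX) ∂ρ = 0 := by
    have h2 := integral_map hXm.aemeasurable (μ := ρ) (f := fun x : ℝ => x) (by fun_prop)
    rw [integral_sub (hXL.integrable (by norm_num)) (integrable_const _), ← h2, hX]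
    rw [gauss_mean]
    simp
  have hB0 : ∫ w, (Y w - m) ∂ρ = 0 := by
    rw [integral_sub (hYL.integrable (by norm_num)) (integrable_const _), hm]
    simp
  have hA2 : ∫ w, (X w - μX) ^ 2 ∂ρ = σX ^ 2 := by
    have h2 := integral_map hXm.aemeasurable (μ := ρ) (f := fun x : ℝ => (x - μX) ^ 2) (by fun_prop)
    rw [← h2, hX, gauss_var]
  have key := fun a => sq_cost ρ _ _ hA hB a
  have e1 : ∀ w, (X w - (scaleFac σX s2 * (Y w - m) + μX)) ^ 2 =
    ((X w - μX) - scaleFac σX s2 * (Y w - m)) ^ 2 := fun w => by ring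
  simp_rw [e1]
  rw [(key _).2]
  have hXYi : Integrable (fun w => (X w - Y w) ^ 2) ρ := (hXL.sub hYL).integrable_sq
  rw [← ofReal_integral_eq_lintegral_ofReal hXYi (ae_of_all _ fun w => sq_nonneg _)]
  apply ENNReal.ofReal_le_ofReal
  have e2 : ∫ w, (X w - Y w) ^ 2 ∂ρ = ∫ w, ((X w - μX) - 1 * (Y w - m)) ^ 2 ∂ρ + (μX - m) ^ 2 := by
    have e3 : ∀ w, (X w - Y w) ^ 2 = ((X w - μX) - 1 * (Y w - m)) ^ 2 +
        ((2 * (μX - m) * (X w - μX) - 2 * (μX - m) * (Y w - m)) + (μX - m) ^ 2) := fun w => by ring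
    simp_rw [e3]
    have hAi : Integrable (fun w => X w - μX) ρ := hA.integrable (by norm_num)
    have hBi : Integrable (fun w => Y w - m) ρ := hB.integrable (by norm_num)
    have i1 : Integrable (fun w => ((X w - μX) - 1 * (Y w - m)) ^ 2) ρ :=
      (hA.sub (hB.const_mul 1)).integrable_sq
    have i2 : Integrable (fun w => 2 * (μX - m) * (X w - μX) - 2 * (μX - m) * (Y w - m)) ρ :=
      (hAi.const_mul _).sub (hBi.const_mul _)
    have i3 : Integrable (fun w => (2 * (μX - m) * (X w - μX) - 2 * (μX - m) * (Y w - m)) +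
      (μX - m) ^ 2) ρ := i2.add (integrable_const _)
    rw [integral_add i1 i3, integral_add i2 (integrable_const _),
      integral_sub (hAi.const_mul _) (hBi.const_mul _), integral_const_mul, integral_const_mul,
      hA0, hB0]
    simp
  rw [e2, (key 1).1, hA2, ← hs2]
  apply distortion_alg σX s2 _ _ hσX
  intro _
  have := (key (σX / Real.sqrt s2)).1
  rw [hA2, ← hs2] at this
  rw [← this]
  exact integral_nonneg fun w => sq_nonneg _

end helpers3
section helpers4
open Filter Topology

/-- Invertible affine reparametrization of the line. -/
noncomputable def affEquiv (a b m : ℝ) (ha : a ≠ 0) : ℝ ≃ᵐ ℝ where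
  toFun := fun y => a * (y - m) + b
  invFun := fun z => (z - b) / a + m
  left_inv := by intro y; simp only; field_simp; ring
  right_inv := by intro y; simp only; field_simp; ring
  measurable_toFun := by simp only [Equiv.coe_fn_mk]; fun_prop
  measurable_invFun := by simp only [Equiv.coe_fn_symm_mk]; fun_prop

lemma condIndepFun_map {Ω Ω' : Type*} [MeasurableSpace Ω] [MeasurableSpace Ω']
    [StandardBorelSpace Ω] [StandardBorelSpace Ω'] {μ : Measure Ω}
    [IsProbabilityMeasure μ] {e : Ω → Ω'} [IsProbabilityMeasure (μ.map e)] (he : Measurable e)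
    (f g k : Ω' → ℝ) (hf : Measurable f) (hg : Measurable g) (hk : Measurable k)
    (hke : Measurable (k ∘ e))
    (h : CondIndepFun (MeasurableSpace.comap (k ∘ e) inferInstance) hke.comap_le
      (f ∘ e) (g ∘ e) μ) :
    CondIndepFun (MeasurableSpace.comap k inferInstance) hk.comap_le f g (μ.map e) := by
  have h5 := (condIndepFun_iff_map_prod_eq_prod_condDistrib_prod_condDistrib
    (hf.comp he) (hg.comp he) hke).1 h
  refine (condIndepFun_iff_map_prod_eq_prod_condDistrib_prod_condDistrib hf hg hk).2 ?_
  have e1 : condDistrib f k (μ.map e) = condDistrib (f ∘ e) (k ∘ e) μ := by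
    simp only [condDistrib]
    congr 1
    rw [Measure.map_map (by fun_prop) he]
    rfl
  have e2 : condDistrib g k (μ.map e) = condDistrib (g ∘ e) (k ∘ e) μ := by
    simp only [condDistrib]
    congr 1
    rw [Measure.map_map (by fun_prop) he]
    rfl
  rw [e1, e2, Measure.map_map (by fun_prop) he, Measure.map_map (by fun_prop) he]
  exact h5

lemma feasible_map (pX : Measure ℝ) (φ ψ : Measure ℝ → Measure ℝ → ℝ≥0∞) (R Rc P Q : ℝ≥0∞)
    (μ : Measure (ℝ × ℝ × ℝ)) (h : DRPfeasible pX φ R Rc P μ) (T : ℝ ≃ᵐ ℝ)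
    (hψ : ψ pX ((μ.map fun w => w.2.2).map T) ≤ Q) :
    DRPfeasible pX ψ R Rc Q (μ.map fun w => (w.1, w.2.1, T w.2.2)) := by
  obtain ⟨hμ, h1, h2, h3, h4, -⟩ := h
  have hT : Measurable T := T.measurable
  have he : Measurable fun w : ℝ × ℝ × ℝ => (w.1, w.2.1, T w.2.2) := by fun_prop
  have hμ' : IsProbabilityMeasure (μ.map fun w => (w.1, w.2.1, T w.2.2)) :=
    Measure.isProbabilityMeasure_map he.aemeasurable
  refine ⟨hμ', ?_, ?_, ?_, ?_, ?_⟩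
  · rw [Measure.map_map (by fun_prop) he]
    exact h1
  · have h2' := h2.comp measurable_id hT
    exact condIndepFun_map (μ := μ) he (fun w : ℝ × ℝ × ℝ => w.1) (fun w => w.2.2) (fun w => w.2.1)
      measurable_fst (by fun_prop) (measurable_fst.comp measurable_snd)
      ((measurable_fst.comp measurable_snd).comp he) h2'
  · unfold mutInfo at h3 ⊢
    rw [Measure.map_map (by fun_prop) he, Measure.map_map (by fun_prop) he,
      Measure.map_map (by fun_prop) he]
    exact h3
  · unfold mutInfo at h4 ⊢
    rw [Measure.map_map (by fun_prop) he, Measure.map_map (by fun_prop) he,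
      Measure.map_map (by fun_prop) he]
    refine le_trans ?_ h4
    have p1 : IsProbabilityMeasure (μ.map fun w : ℝ × ℝ × ℝ => (w.2.2, w.2.1)) :=
      Measure.isProbabilityMeasure_map (by fun_prop)
    have p2 : IsProbabilityMeasure (μ.map fun w : ℝ × ℝ × ℝ => w.2.2) :=
      Measure.isProbabilityMeasure_map (by fun_prop)
    have p3 : IsProbabilityMeasure (μ.map fun w : ℝ × ℝ × ℝ => w.2.1) :=
      Measure.isProbabilityMeasure_map (by fun_prop)
    have hk := KLD_map_le (MeasurableEquiv.prodCongr T (MeasurableEquiv.refl ℝ))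
      (μ.map fun w : ℝ × ℝ × ℝ => (w.2.2, w.2.1))
      ((μ.map fun w : ℝ × ℝ × ℝ => w.2.2).prod (μ.map fun w : ℝ × ℝ × ℝ => w.2.1))
    refine le_trans (le_of_eq ?_) hk
    congr 1
    · rw [Measure.map_map (MeasurableEquiv.measurable _) (by fun_prop)]
      rfl
    · have : ⇑(MeasurableEquiv.prodCongr T (MeasurableEquiv.refl ℝ)) = Prod.map T id := rfl
      rw [this, ← Measure.map_prod_map _ _ hT measurable_id, Measure.map_id,
        Measure.map_map hT (by fun_prop)]
      rfl
  · rw [Measure.map_map (by fun_prop) he]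
    rw [Measure.map_map hT (by fun_prop)] at hψ
    exact hψ

end helpers4

/-- `D(R, R_c, 2σ_X²(1-e^{-P}) | W₂²) ≤ D(R, R_c, P | φ_KL)` for Gaussian sources. -/
theorem stmt5 (μX σX : ℝ) (hσX : 0 < σX) (R Rc P : ℝ≥0∞) :
    DRP (gauss μX σX) W2sq R Rc (ENNReal.ofReal (2 * σX ^ 2 * (1 - expNeg P))) ≤
      DRP (gauss μX σX) (fun p q => KLD q p) R Rc P := by
  refine le_iInf₂ fun μ hfeas => ?_
  by_cases htop : distortion μ = ⊤
  · rw [htop]; exact le_top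
  obtain ⟨hμ, h1, -, -, -, hKL⟩ := id hfeas
  have hXL : MemLp (fun w : ℝ × ℝ × ℝ => w.1) 2 μ := by
    have := gauss_memLp μX σX
    rw [← h1] at this
    exact (memLp_map_measure_iff (f := fun w : ℝ × ℝ × ℝ => w.1) (g := id)
      (by fun_prop) (by fun_prop)).1 this
  have hDL : MemLp (fun w : ℝ × ℝ × ℝ => w.1 - w.2.2) 2 μ := by
    rw [memLp_two_iff_integrable_sq (by fun_prop)]
    refine ⟨by fun_prop, ?_⟩
    rw [hasFiniteIntegral_iff_ofReal (ae_of_all _ fun w => sq_nonneg _)]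
    exact lt_top_iff_ne_top.2 htop
  have hYL : MemLp (fun w : ℝ × ℝ × ℝ => w.2.2) 2 μ := by
    have := hXL.sub hDL
    refine this.congr_norm (by fun_prop) (ae_of_all _ fun w => ?_)
    simp
  set q := μ.map (fun w : ℝ × ℝ × ℝ => w.2.2) with hq
  have hqp : IsProbabilityMeasure q := Measure.isProbabilityMeasure_map (by fun_prop)
  have hL2 : MemLp id 2 q := (memLp_map_measure_iff (by fun_prop) (by fun_prop)).2 hYL
  have hper := perception μX σX hσX q hL2 P hKL
  set m := ∫ x, x ∂q with hm
  set s2 := ∫ y, (y - m) ^ 2 ∂q with hs2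
  have hm' : m = ∫ w, w.2.2 ∂μ := by
    rw [hm, hq, integral_map (by fun_prop) (by fun_prop)]
  have hs2' : s2 = ∫ w, (w.2.2 - m) ^ 2 ∂μ := by
    rw [hs2, hq, integral_map (by fun_prop) (by fun_prop)]
  let T := affEquiv (scaleFac σX s2) μX m (scaleFac_pos σX s2 hσX).ne'
  have hf := feasible_map (gauss μX σX) _ W2sq R Rc P
    (ENNReal.ofReal (2 * σX ^ 2 * (1 - expNeg P))) μ hfeas T hper
  refine (iInf₂_le _ hf).trans ?_
  have hT : Measurable T := T.measurable
  unfold distortion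
  rw [lintegral_map (by fun_prop) (by fun_prop)]
  exact distortion_le μX σX hσX μ (fun w => w.1) (fun w => w.2.2) (by fun_prop) (by fun_prop)
    h1 hXL hYL m s2 hm' hs2'
end

section
/- Let σ_X > 0, R, R_c ∈ [0,∞], and P ∈ [0,∞). Then σ_X² − σ_X² ξ(R,R_c)² + (max{σ_X − √P − σ_X ξ(R,R_c), 0})² ≤ σ_X² − σ_X² ξ(R,R_c)² + (max{σ(ν(P)) − σ_X ξ(R,R_c), 0})², where ν(P) := log(2σ_X² / max{2σ_X² − P, 0}) (with ν(P) = +∞ and σ(∞) := 0 when P ≥ 2σ_X²). (That is, the explicit upper bound D̄(R,R_c,P|W₂²) is at most the explicit upper bound D̄(R,R_c,ν(P)|φ_KL).) -/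
open MeasureTheory ProbabilityTheory Real Set
open scoped ENNReal NNReal

/-- The explicit squared-Wasserstein-2 upper bound is dominated by the induced KL upper bound. -/
theorem stmt7 (σX : ℝ) (hσX : 0 < σX) (R Rc : ℝ≥0∞) (P : ℝ) (hP : 0 ≤ P)
    (s : ℝ)
    (h1 : P < 2 * σX ^ 2 → s ∈ Set.Icc 0 σX ∧
      psi σX s = Real.log ((2 * σX ^ 2) / (2 * σX ^ 2 - P)))
    (h2 : 2 * σX ^ 2 ≤ P → s = 0) :
    σX ^ 2 - σX ^ 2 * xiRRc R Rc ^ 2 +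
        max (σX - Real.sqrt P - σX * xiRRc R Rc) 0 ^ 2 ≤
      σX ^ 2 - σX ^ 2 * xiRRc R Rc ^ 2 + max (s - σX * xiRRc R Rc) 0 ^ 2 := by
  have key : max (σX - Real.sqrt P - σX * xiRRc R Rc) 0 ≤ max (s - σX * xiRRc R Rc) 0 := by
    apply max_le_max _ le_rfl
    apply sub_le_sub_right
    rcases lt_or_ge P (2 * σX ^ 2) with h | h
    · obtain ⟨⟨hs0, hs1⟩, hpsi⟩ := h1 h
      unfold psi at hpsi
      have hA : 0 < 2 * σX ^ 2 - P := by linarith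
      have hs : 0 < s := by
        rcases hs0.lt_or_eq with h0 | h0
        · exact h0
        · exfalso
          rw [← h0] at hpsi
          have e : (((0 : ℝ) ^ 2 - σX ^ 2) / (2 * σX ^ 2)) = -1 / 2 := by
            field_simp
            ring
          rw [e, div_zero, Real.log_zero] at hpsi
          have : 0 ≤ Real.log ((2 * σX ^ 2) / (2 * σX ^ 2 - P)) := by
            apply Real.log_nonneg
            rw [le_div_iff₀ hA]
            linarith
          linarith
      by_contra hcon
      push Not at hcon
      have hsq : 0 ≤ Real.sqrt P := Real.sqrt_nonneg P
      have hPs : P < (σX - s) ^ 2 := by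
        have := Real.sq_sqrt hP
        nlinarith
      have hlog : Real.log ((2 * σX ^ 2 - P) / (2 * σX * s)) =
          -((s ^ 2 - σX ^ 2) / (2 * σX ^ 2)) := by
        rw [Real.log_div (by positivity) hs.ne', Real.log_div (by positivity) hA.ne'] at hpsi
        rw [Real.log_div hA.ne' (by positivity), Real.log_mul (by positivity) hs.ne']
        have e : Real.log (2 * σX ^ 2) = Real.log (2 * σX) + Real.log σX := by
          rw [← Real.log_mul (by positivity) (by positivity)]
          congr 1
          ring
        linarith
      have hb := Real.one_sub_inv_le_log_of_pos
        (show 0 < (2 * σX ^ 2 - P) / (2 * σX * s) by positivity)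
      rw [hlog, inv_div] at hb
      have hB : 0 < 2 * σX ^ 2 - (σX - s) ^ 2 := by nlinarith
      have hc : 2 * σX * s / (2 * σX ^ 2 - P) <
          2 * σX * s / (2 * σX ^ 2 - (σX - s) ^ 2) := by
        apply div_lt_div_of_pos_left (by positivity) hB (by linarith)
      have hd : 1 - 2 * σX * s / (2 * σX ^ 2 - (σX - s) ^ 2) =
          (σX ^ 2 - s ^ 2) / (2 * σX ^ 2 - (σX - s) ^ 2) := by
        rw [eq_div_iff hB.ne', sub_mul, div_mul_cancel₀ _ hB.ne']
        ring
      have he : (σX ^ 2 - s ^ 2) / (2 * σX ^ 2) ≤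
          (σX ^ 2 - s ^ 2) / (2 * σX ^ 2 - (σX - s) ^ 2) := by
        apply div_le_div_of_nonneg_left (by nlinarith) hB (by nlinarith)
      have hf : -((s ^ 2 - σX ^ 2) / (2 * σX ^ 2)) = (σX ^ 2 - s ^ 2) / (2 * σX ^ 2) := by
        ring
      linarith
    · rw [h2 h, sub_nonpos]
      apply Real.le_sqrt_of_sq_le
      nlinarith
  have := pow_le_pow_left₀ (le_max_right _ _) key 2
  linarith
end

section
/- Let σ_X > 0, R_c ∈ (0,∞), and P ∈ (0, σ_X²). Then the inequality P ≥ σ_X²(2 − e^{−2R} − 2√((1 − e^{−2R})(1 − e^{−2(R+R_c)}))) holds for R ≥ 0 if and only if R ≥ −(1/2)·log ẑ, where ẑ := ζ₃/ζ₂ if R_c = log 2 and ẑ := (ζ₂ − √(ζ₂² − 4ζ₁ζ₃))/(2ζ₁) otherwise, with ζ₁ := 4e^{−2R_c} − 1, ζ₂ := 4e^{−2R_c} + 2P/σ_X², ζ₃ := (4σ_X² − P)P/σ_X⁴. Moreover, if P ≥ σ_X², the inequality holds for all R ≥ 0. -/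
open MeasureTheory ProbabilityTheory Real Set
open scoped ENNReal NNReal

/-- Core algebra: sign of the quadratic against its smaller positive root. -/
lemma core_quad (a p z s : ℝ) (ha : 0 < a) (ha1 : a < 1) (hp : 0 < p) (hp1 : p < 1)
    (hz : 0 < z) (hz1 : z ≤ 1) (hs0 : 0 ≤ s)
    (hs : s ^ 2 = (4 * a + 2 * p) ^ 2 - 4 * (4 * a - 1) * ((4 - p) * p)) :
    (2 - z - 2 * Real.sqrt ((1 - z) * (1 - z * a)) ≤ p ↔
      z ≤ 2 * ((4 - p) * p) / (4 * a + 2 * p + s)) := by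
  have hden : 0 < 4 * a + 2 * p + s := by positivity
  have hza : z * a < 1 := by nlinarith
  have hfac : 0 < (4 * a + 2 * p + s) - 2 * (4 * a - 1) * z := by
    rcases le_or_gt (4 * a - 1) 0 with h | h
    · nlinarith
    · have h2 : 2 * (4 * a - 1) - (4 * a + 2 * p) < s := by
        apply lt_of_pow_lt_pow_left₀ 2 hs0
        have : 0 < (4 * a - 1) * (1 - p) ^ 2 := by
          have : 0 < 1 - p := by linarith
          positivity
        rw [hs]
        nlinarith
      nlinarith
  have h1 : (2 - z - 2 * Real.sqrt ((1 - z) * (1 - z * a)) ≤ p) ↔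
      (2 - z - p) / 2 ≤ Real.sqrt ((1 - z) * (1 - z * a)) := by
    constructor <;> intro h <;> linarith
  rw [h1, Real.le_sqrt' (by linarith), le_div_iff₀ hden]
  have hid : ((1 - z) * (1 - z * a) - ((2 - z - p) / 2) ^ 2) * (8 * (4 * a + 2 * p + s)) =
      (2 * ((4 - p) * p) - z * (4 * a + 2 * p + s)) *
        (4 * a + 2 * p + s - 2 * (4 * a - 1) * z) := by
    linear_combination z * hs
  constructor
  · intro h
    by_contra hc
    push Not at hc
    nlinarith [mul_pos (sub_pos.2 hc) hfac, mul_nonneg (sub_nonneg.2 h) hden.le]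
  · intro h
    by_contra hc
    push Not at hc
    nlinarith [mul_nonneg (sub_nonneg.2 h) hfac.le, mul_pos (sub_pos.2 hc) hden]

/-- The rate-threshold characterization of the region where the two lower bounds coincide. -/
theorem stmt11 (σX : ℝ) (hσX : 0 < σX) (Rc : ℝ) (hRc : 0 < Rc) :
    (∀ P : ℝ, 0 < P → P < σX ^ 2 → ∀ R : ℝ, 0 ≤ R →
      (σX ^ 2 * (2 - Real.exp (-2 * R) - 2 * Real.sqrt ((1 - Real.exp (-2 * R)) *
          (1 - Real.exp (-2 * (R + Rc))))) ≤ P ↔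
        R ≥ -(1 / 2) * Real.log
          (if Rc = Real.log 2 then
            ((4 * σX ^ 2 - P) * P / σX ^ 4) / (4 * Real.exp (-2 * Rc) + 2 * P / σX ^ 2)
          else
            ((4 * Real.exp (-2 * Rc) + 2 * P / σX ^ 2) -
              Real.sqrt ((4 * Real.exp (-2 * Rc) + 2 * P / σX ^ 2) ^ 2 -
                4 * (4 * Real.exp (-2 * Rc) - 1) * ((4 * σX ^ 2 - P) * P / σX ^ 4))) /
            (2 * (4 * Real.exp (-2 * Rc) - 1))))) ∧
    (∀ P : ℝ, σX ^ 2 ≤ P → ∀ R : ℝ, 0 ≤ R →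
      σX ^ 2 * (2 - Real.exp (-2 * R) - 2 * Real.sqrt ((1 - Real.exp (-2 * R)) *
        (1 - Real.exp (-2 * (R + Rc))))) ≤ P) := by
  have hσ2 : 0 < σX ^ 2 := by positivity
  have ha : 0 < Real.exp (-2 * Rc) := Real.exp_pos _
  have ha1 : Real.exp (-2 * Rc) < 1 := by
    rw [← Real.exp_zero]
    exact Real.exp_lt_exp.2 (by linarith)
  have hsplit : ∀ R : ℝ, Real.exp (-2 * (R + Rc)) = Real.exp (-2 * R) * Real.exp (-2 * Rc) := by
    intro R
    rw [← Real.exp_add]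
    ring_nf
  have hlog : Rc = Real.log 2 ↔ 4 * Real.exp (-2 * Rc) - 1 = 0 := by
    have h4 : Real.exp (-2 * Real.log 2) = 1 / 4 := by
      have : -2 * Real.log 2 = -(Real.log 2 + Real.log 2) := by ring
      rw [this, Real.exp_neg, Real.exp_add, Real.exp_log (by norm_num)]
      norm_num
    constructor
    · intro h
      rw [h, h4]
      norm_num
    · intro h
      have : Real.exp (-2 * Rc) = Real.exp (-2 * Real.log 2) := by rw [h4]; linarith
      have := Real.exp_injective this
      linarith
  constructor
  · intro P hP hPσ R hR
    rw [hsplit]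
    simp only [hlog]
    have hz : 0 < Real.exp (-2 * R) := Real.exp_pos _
    have hz1 : Real.exp (-2 * R) ≤ 1 := Real.exp_le_one_iff.2 (by linarith)
    obtain ⟨p, hp⟩ : ∃ p, p = P / σX ^ 2 := ⟨_, rfl⟩
    have hPp : P = σX ^ 2 * p := by rw [hp]; field_simp
    have hp0 : 0 < p := by rw [hp]; positivity
    have hp1 : p < 1 := by rw [hp, div_lt_one hσ2]; exact hPσ
    have e1 : (4 * σX ^ 2 - P) * P / σX ^ 4 = (4 - p) * p := by
      rw [hPp]; field_simp
    have e2 : 2 * P / σX ^ 2 = 2 * p := by rw [hp]; ring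
    rw [e1, e2]
    generalize Real.exp (-2 * Rc) = a at *
    have hexp : ∀ w : ℝ, 0 < w →
        (R ≥ -(1 / 2) * Real.log w ↔ Real.exp (-2 * R) ≤ w) := by
      intro w hw
      rw [← Real.le_log_iff_exp_le hw]
      constructor <;> intro h <;> linarith
    have hz3 : 0 < (4 - p) * p := mul_pos (by linarith) hp0
    have hdisc : 0 ≤ (4 * a + 2 * p) ^ 2 - 4 * (4 * a - 1) * ((4 - p) * p) := by
      rcases le_or_gt (4 * a - 1) 0 with h | h
      · nlinarith [mul_nonneg (neg_nonneg.2 h) hz3.le, sq_nonneg (4 * a + 2 * p)]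
      · nlinarith [mul_nonneg h.le (sq_nonneg (1 - p)),
          sq_nonneg (4 * a + 2 * p - 2 * (4 * a - 1))]
    obtain ⟨s, hsdef⟩ : ∃ s, s = Real.sqrt
      ((4 * a + 2 * p) ^ 2 - 4 * (4 * a - 1) * ((4 - p) * p)) := ⟨_, rfl⟩
    have hs0 : 0 ≤ s := by rw [hsdef]; exact Real.sqrt_nonneg _
    have hs : s ^ 2 = (4 * a + 2 * p) ^ 2 - 4 * (4 * a - 1) * ((4 - p) * p) := by
      rw [hsdef]; exact Real.sq_sqrt hdisc
    rw [← hsdef]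
    have hden : 0 < 4 * a + 2 * p + s := by positivity
    have hw : (if 4 * a - 1 = 0 then (4 - p) * p / (4 * a + 2 * p)
        else (4 * a + 2 * p - s) / (2 * (4 * a - 1))) =
        2 * ((4 - p) * p) / (4 * a + 2 * p + s) := by
      split_ifs with h
      · have : s = 4 * a + 2 * p := by
          rw [hsdef, h, mul_zero, zero_mul, sub_zero]
          exact Real.sqrt_sq (by positivity)
        rw [this]
        have : 4 * a + 2 * p ≠ 0 := by positivity
        rw [div_eq_div_iff this (by positivity)]
        ring
      · rw [div_eq_div_iff (mul_ne_zero two_ne_zero h) hden.ne']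
        linear_combination -hs
    rw [hw, hexp _ (by positivity),
      ← core_quad a p _ s ha ha1 hp0 hp1 hz hz1 hs0 hs, hPp, mul_le_mul_iff_right₀ hσ2]
  · intro P hP R hR
    rw [hsplit]
    have hz : 0 < Real.exp (-2 * R) := Real.exp_pos _
    have hz1 : Real.exp (-2 * R) ≤ 1 := Real.exp_le_one_iff.2 (by linarith)
    generalize Real.exp (-2 * Rc) = a at *
    generalize Real.exp (-2 * R) = z at *
    have h : 1 - z ≤ Real.sqrt ((1 - z) * (1 - z * a)) := by
      apply Real.le_sqrt_of_sq_le
      nlinarith [mul_nonneg (sub_nonneg.2 hz1) (mul_nonneg hz.le (sub_nonneg.2 ha1.le))]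
    nlinarith
end
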